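/- Let Φ ∈ Π̃(K) satisfy the one-dimensional associator equations with μ = 0, and set Φ∞ := Φ(e0,e∞). For integers a_d,…,a_0 ≥ 0 write W(a_d; a_{d−1},…,a_1; a_0) := e0^{a_d} e1 e0^{a_{d−1}} e1 ⋯ e1 e0^{a_1} e1 e0^{a_0} (a word of depth d). Then for all d ≥ 1, all s_d,…,s_0 ≥ 1 and all r_d, r_0 ≥ 0, the element binom(s_0+s_d+r_0+r_d−1, s_0+s_d−1)·Φ∞[W(s_d−1+r_d; s_{d−1}−1,…,s_1−1; s_0−1+r_0)] − Σ_{u_{d−1}+⋯+u_1 = r_d+r_0, u_j ≥ 0} (Π_{j=1}^{d−1} binom(−s_j, u_j))·Φ∞[W(s_d−1; s_{d−1}−1+u_{d−1},…,s_1−1+u_1; s_0−1)] belongs to the ℚ-subalgebra of K generated by the coefficients Φ∞[v] over all words v of depth at most d−1. -/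

import Mathlib

/-! Infrastructure: noncommutative formal power series in two letters `e0, e1`,
their ring structure, exponential, inverse, substitution, shuffle products,
and the various words and submodules of coefficients used in the statements. -/

/-- Words over the alphabet `{e0, e1}`: lists over `Fin 2` (`0` is `e0`, `1` is `e1`),
read from left to right. -/
abbrev Word : Type := List (Fin 2)

/-- The depth of a word: its number of letters `e1`. -/
def depth (w : Word) : ℕ := w.count 1

/-- Noncommutative formal power series in `e0, e1` over `K`, encoded by their
coefficient functions on words. -/
def NCS (K : Type*) : Type _ := Word → K

namespace NCS

variable {K : Type*} [CommRing K]

instance : AddCommGroup (NCS K) := Pi.addCommGroup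
instance : SMul K (NCS K) := ⟨fun c f => fun w => c * f w⟩
instance : One (NCS K) := ⟨fun w => if w = [] then 1 else 0⟩
/-- Multiplication of noncommutative power series (Cauchy product on words). -/
instance : Mul (NCS K) := ⟨fun f g => fun w =>
  ∑ i ∈ Finset.range (w.length + 1), f (w.take i) * g (w.drop i)⟩

lemma mul_apply (f g : NCS K) (w : Word) :
    (f * g) w = ∑ i ∈ Finset.range (w.length + 1), f (w.take i) * g (w.drop i) := rfl

lemma add_apply (f g : NCS K) (w : Word) : (f + g) w = f w + g w := rfl

lemma smul_apply (c : K) (f : NCS K) (w : Word) : (c • f) w = c * f w := rfl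

lemma zero_apply (w : Word) : (0 : NCS K) w = 0 := rfl

lemma one_apply (w : Word) : (1 : NCS K) w = if w = [] then 1 else 0 := rfl

/-- Left shift of the coefficient function by a letter. -/
def shift (a : Fin 2) (f : NCS K) : NCS K := fun w => f (a :: w)

lemma mul_nil (f g : NCS K) : (f * g) [] = f [] * g [] := by
  simp [mul_apply]

lemma cons_mul (f g : NCS K) (a : Fin 2) (w : Word) :
    (f * g) (a :: w) = f [] * g (a :: w) + (shift a f * g) w := by
  show (∑ i ∈ Finset.range (w.length + 1 + 1), f ((a :: w).take i) * g ((a :: w).drop i)) = _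
  rw [Finset.sum_range_succ']
  simp only [List.take_succ_cons, List.drop_succ_cons, List.take_zero, List.drop_zero]
  rw [add_comm]
  rfl

private lemma zero_mul' (f : NCS K) : 0 * f = 0 := by
  funext w; simp [mul_apply, zero_apply]

private lemma mul_zero' (f : NCS K) : f * 0 = 0 := by
  funext w; simp [mul_apply, zero_apply]

private lemma add_mul' (f g h : NCS K) : (f + g) * h = f * h + g * h := by
  funext w
  simp [mul_apply, add_apply, add_mul, Finset.sum_add_distrib]

private lemma mul_add' (f g h : NCS K) : f * (g + h) = f * g + f * h := by
  funext w
  simp [mul_apply, add_apply, mul_add, Finset.sum_add_distrib]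

private lemma smul_mul' (c : K) (f g : NCS K) : (c • f) * g = c • (f * g) := by
  funext w
  simp [mul_apply, smul_apply, Finset.mul_sum, mul_assoc]

private lemma one_mul' (f : NCS K) : 1 * f = f := by
  funext w
  cases w with
  | nil => simp [mul_nil, one_apply]
  | cons a w =>
      have : shift a (1 : NCS K) = 0 := by
        funext v; show (if (a :: v : Word) = [] then (1:K) else 0) = 0; simp
      rw [cons_mul, this, zero_mul', zero_apply, one_apply]
      simp

private lemma mul_one' (f : NCS K) : f * 1 = f := by
  funext w
  induction w generalizing f with
  | nil => simp [mul_nil, one_apply]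
  | cons a w ih =>
      rw [cons_mul, one_apply, ih]
      simp [shift]

private lemma mul_assoc' (f g h : NCS K) : f * g * h = f * (g * h) := by
  funext w
  induction w generalizing f g h with
  | nil =>
      simp only [mul_nil]
      ring
  | cons a w ih =>
      have h1 : shift a (f * g) = f [] • shift a g + shift a f * g := by
        funext v
        show (f * g) (a :: v) = _
        rw [cons_mul]
        rfl
      have e1 : (f * g * h) (a :: w)
          = f [] * g [] * h (a :: w)
            + (f [] * ((shift a g * h) w) + ((shift a f * g) * h) w) := by
        rw [cons_mul, h1, add_mul', smul_mul', mul_nil, add_apply, smul_apply]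
      have e2 : (f * (g * h)) (a :: w)
          = f [] * (g [] * h (a :: w) + (shift a g * h) w)
            + (shift a f * (g * h)) w := by
        rw [cons_mul, cons_mul]
      rw [e1, e2, ih]
      ring

instance instRing : Ring (NCS K) where
  __ := (inferInstance : AddCommGroup (NCS K))
  __ := (inferInstance : Mul (NCS K))
  __ := (inferInstance : One (NCS K))
  left_distrib := mul_add'
  right_distrib := add_mul'
  zero_mul := zero_mul'
  mul_zero := mul_zero'
  mul_assoc := mul_assoc'
  one_mul := one_mul'
  mul_one := mul_one'

/-- The inverse of a noncommutative power series, given by the geometric series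
`Σ_k (1-f)^k`.  For `f` with constant coefficient `1` (the only case used) this is
the genuine two-sided multiplicative inverse of `f`. -/
instance : Inv (NCS K) :=
  ⟨fun f => fun w => ∑ k ∈ Finset.range (w.length + 1), ((1 - f) ^ k) w⟩

/-- The series `e0`. -/
def E0 : NCS K := fun w => if w = [0] then 1 else 0

/-- The series `e1`. -/
def E1 : NCS K := fun w => if w = [1] then 1 else 0

/-- The series `e∞ = -e0 - e1`. -/
def Einf : NCS K := -E0 - E1

/-- The finite set of all words of length at most `n`. -/
def wordsLe (n : ℕ) : Finset Word :=
  (Finset.range (n + 1)).biUnion fun k =>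
    Finset.image (fun t : Fin k → Fin 2 => List.ofFn t) Finset.univ

/-- The product of the letters of `w` after the substitution `e0 ↦ a`, `e1 ↦ b`. -/
def prodWord (a b : NCS K) (w : Word) : NCS K :=
  (w.map fun c => if c = 0 then a else b).prod

/-- Substitution `f(e0,e1) ↦ f(a,b)`: the image of `f` under the continuous algebra
endomorphism determined by `e0 ↦ a`, `e1 ↦ b` (for `a`, `b` with zero constant term). -/
def subst (a b : NCS K) (f : NCS K) : NCS K :=
  fun v => ∑ w ∈ wordsLe v.length, f w * prodWord a b w v

/-- The exponential series `exp a = Σ_k a^k/k!` (for `a` with zero constant term). -/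
def expS {K : Type*} [Field K] (a : NCS K) : NCS K :=
  fun w => ∑ k ∈ Finset.range (w.length + 1), (Nat.factorial k : K)⁻¹ * (a ^ k) w

end NCS

/-- The list of all shuffles of two words. -/
def shuffle : Word → Word → List Word
  | [], v => [v]
  | a :: u, [] => [a :: u]
  | a :: u, b :: v =>
      ((shuffle u (b :: v)).map fun w => a :: w) ++ ((shuffle (a :: u) v).map fun w => b :: w)
termination_by u v => u.length + v.length

namespace NCS

variable {K : Type*} [CommRing K]

/-- `f[u ⧢ v]`: the coefficient function `f` applied linearly to the shuffle `u ⧢ v`. -/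
def shufApply (f : NCS K) (u v : Word) : K := ((shuffle u v).map fun w => f w).sum

/-- `f ∈ Π(K)`: group-like elements, i.e. solutions of the shuffle equations with
constant coefficient `1`. -/
def IsPi (f : NCS K) : Prop :=
  f [] = 1 ∧ ∀ u v : Word, shufApply f u v = f u * f v

/-- `f ∈ Π̃(K)`: elements of `Π(K)` whose weight-one coefficients vanish. -/
def IsPiT (f : NCS K) : Prop := IsPi f ∧ f [0] = 0 ∧ f [1] = 0

end NCS

/-- The block `e0^{k-1} e1`. -/
def blk (k : ℕ) : Word := List.replicate (k - 1) 0 ++ [1]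

/-- The word `e0^{s_d-1} e1 e0^{s_{d-1}-1} e1 ⋯ e0^{s_1-1} e1` (only the values
`s 1, …, s d` matter). -/
def wordW (d : ℕ) (s : ℕ → ℕ) : Word :=
  (List.ofFn fun j : Fin d => blk (s (d - (j : ℕ)))).flatten

/-- The word `e0^{s_d-1} e1 ⋯ e0^{s_1-1} e1 e0^{s_0-1}`. -/
def word1 (d : ℕ) (s : ℕ → ℕ) : Word :=
  wordW d s ++ List.replicate (s 0 - 1) 0

/-- The word `W(a_d; a_{d-1}, …, a_1; a_0) = e0^{a_d} e1 e0^{a_{d-1}} e1 ⋯ e1 e0^{a_1} e1 e0^{a_0}`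
of depth `d`. -/
def wordA (d : ℕ) (a : ℕ → ℕ) : Word :=
  List.replicate (a d) 0 ++
    (List.ofFn fun j : Fin d => (1 : Fin 2) :: List.replicate (a (d - 1 - (j : ℕ))) 0).flatten

/-- `binom (−s, l) = (−1)^l · binom (s+l−1, l)`. -/
def nbinom (s l : ℕ) : ℤ := (-1) ^ l * ((s + l - 1).choose l)

/-- Extension of a tuple `t : Fin d → ℕ` to `ℕ → ℕ` so that index `i ∈ {1, …, d}`
reads `t (i-1)` and all other indices read `0`. -/
def extFin (d : ℕ) (t : Fin d → ℕ) : ℕ → ℕ :=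
  fun i => if h : i - 1 < d ∧ 1 ≤ i then t ⟨i - 1, h.1⟩ else 0

namespace NCS

/-- The filtration `Fil_s(C_μ) = Σ_{s1+s2=s} (1/s1!)·ℤ·(μ/2)^{s2}` of `ℚ ⊆ K`
(`μ ≠ 0` case; for `μ = 0` it reduces to `ℤ ⊆ K`). -/
def Fil {K : Type*} [Field K] (μ : K) (s : ℕ) : Submodule ℤ K :=
  Submodule.span ℤ
    {x : K | ∃ s1 s2 : ℕ, s1 + s2 = s ∧ x = (Nat.factorial s1 : K)⁻¹ * (μ / 2) ^ s2}

variable {K : Type*} [CommRing K]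

/-- `M_D(f)`: the ℤ-submodule of `K` generated by the products `f[w_1]⋯f[w_k]`, `k ≥ 1`,
where each `w_j` is a word of depth between `1` and `D`. -/
def Msub (D : ℕ) (f : NCS K) : Submodule ℤ K :=
  Submodule.span ℤ
    {x : K | ∃ l : List Word, l ≠ [] ∧ (∀ w ∈ l, 1 ≤ depth w ∧ depth w ≤ D) ∧
      x = (l.map fun w => f w).prod}

/-- `M^μ_D(f)`: as `Msub` but with coefficients in the filtration `Fil`. -/
def MsubFil {K : Type*} [Field K] (μ : K) (D : ℕ) (f : NCS K) : Submodule ℤ K :=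
  Submodule.span ℤ
    {x : K | ∃ (l : List Word) (c : K), l ≠ [] ∧
      (∀ w ∈ l, 1 ≤ depth w ∧ depth w ≤ D) ∧
      c ∈ Fil μ ((l.map List.length).sum) ∧
      x = c * (l.map fun w => f w).prod}

/-- The one-dimensional associator equations with `μ = 0`: duality (2-cycle), 3-cycle,
and the special automorphism equation. -/
def OneDim0 (Φ : NCS K) : Prop :=
  Φ * subst E1 E0 Φ = 1 ∧
  subst Einf E0 Φ * subst E1 Einf Φ * Φ = 1 ∧
  E0 + Φ⁻¹ * E1 * Φ + (subst E0 Einf Φ)⁻¹ * Einf * subst E0 Einf Φ = 0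

/-- The one-dimensional associator equations with coupling constant `μ ≠ 0`: duality,
hexagon, and the equation of special automorphisms. -/
def OneDimMu {K : Type*} [Field K] (μ : K) (Φ : NCS K) : Prop :=
  subst E1 E0 Φ = Φ⁻¹ ∧
  expS ((μ / 2) • E0) * subst Einf E0 Φ * expS ((μ / 2) • Einf) *
      subst E1 Einf Φ * expS ((μ / 2) • E1) * Φ = 1 ∧
  Φ⁻¹ * expS ((-μ) • E1) * Φ * expS ((-μ) • E0) =
    expS ((μ / 2) • E0) * (subst E0 Einf Φ)⁻¹ * expS (μ • Einf) *
      subst E0 Einf Φ * expS ((-(μ / 2)) • E0)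

end NCS

namespace NCS

section aux1
variable {K : Type*} [CommRing K]

/-- Sum of the values of `f` over all insertions of the letter `c` in a word. -/
def ins (c : Fin 2) : Word → (Word → K) → K
  | [], f => f [c]
  | b :: v, f => f (c :: b :: v) + ins c v (fun w => f (b :: w))

lemma shufApply_single (c : Fin 2) (w : Word) (f : Word → K) :
    ((shuffle [c] w).map f).sum = ins c w f := by
  induction w generalizing f with
  | nil => simp [shuffle, ins]
  | cons b v ih =>
    rw [shuffle, shuffle, ins, ← ih]
    simp [Function.comp_def]

lemma E0_nil : (E0 : NCS K) [] = 0 := by simp [E0]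
lemma E1_nil : (E1 : NCS K) [] = 0 := by simp [E1]
lemma shift00 : shift 0 (E0 : NCS K) = 1 := by
  funext w; simp [shift, E0, one_apply]
lemma shift10 : shift 1 (E0 : NCS K) = 0 := by
  funext w; simp [shift, E0, zero_apply]
lemma shift01 : shift 0 (E1 : NCS K) = 0 := by
  funext w; simp [shift, E1, zero_apply]
lemma shift11 : shift 1 (E1 : NCS K) = 1 := by
  funext w; simp [shift, E1, one_apply]

lemma sub_apply (f g : NCS K) (w : Word) : (f - g) w = f w - g w := rfl
lemma neg_apply (f : NCS K) (w : Word) : (-f) w = - f w := rfl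

lemma E1_mul_cons1 (f : NCS K) (w : Word) : (E1 * f : NCS K) (1 :: w) = f w := by
  rw [cons_mul, E1_nil, shift11, one_mul, zero_mul, zero_add]
lemma E1_mul_cons0 (f : NCS K) (w : Word) : (E1 * f : NCS K) (0 :: w) = 0 := by
  rw [cons_mul, E1_nil, shift01, zero_mul, zero_mul, zero_add, zero_apply]
lemma E0_mul_cons0 (f : NCS K) (w : Word) : (E0 * f : NCS K) (0 :: w) = f w := by
  rw [cons_mul, E0_nil, shift00, one_mul, zero_mul, zero_add]
lemma E0_mul_cons1 (f : NCS K) (w : Word) : (E0 * f : NCS K) (1 :: w) = 0 := by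
  rw [cons_mul, E0_nil, shift10, zero_mul, zero_mul, zero_add, zero_apply]

lemma mul_E0_snoc (h : NCS K) (w : Word) (a : Fin 2) :
    (h * E0 : NCS K) (w ++ [a]) = h w * E0 [a] := by
  induction w generalizing h with
  | nil => rw [List.nil_append, cons_mul, mul_nil, E0_nil]; simp
  | cons b v ih =>
    rw [List.cons_append, cons_mul, ih]
    simp [E0, shift]

/-- splitting of the first term of a product -/
lemma mul_sub_mem {R : Type*} [CommSemiring R] [Algebra R K] (B : Subalgebra R K) (f X : NCS K)
    (hf : f [] = 1) (w : Word)
    (H : ∀ u v : Word, u ≠ [] → w = u ++ v → f u * X v ∈ B) : (f * X) w - X w ∈ B := by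
  rw [mul_apply, Finset.sum_range_succ']
  simp only [List.take_zero, List.drop_zero, hf, one_mul, add_sub_cancel_right]
  refine B.sum_mem fun i hi => H _ _ ?_ (List.take_append_drop _ _).symm
  have := Finset.mem_range.1 hi
  intro h0
  rw [List.take_eq_nil_iff] at h0
  rcases h0 with h0 | h0
  · omega
  · simp [h0] at this

lemma pow_apply_zero (f : NCS K) (hf : f [] = 0) (k : ℕ) (w : Word) (hw : w.length < k) :
    (f ^ k) w = 0 := by
  induction k generalizing w with
  | zero => omega
  | succ k ih =>
    rw [pow_succ', mul_apply]
    refine Finset.sum_eq_zero fun i hi => ?_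
    have := Finset.mem_range.1 hi
    rcases Nat.eq_zero_or_pos i with rfl | hpos
    · simp [hf]
    · rw [ih _ (by simp; omega), mul_zero]

lemma fsum_apply {ι : Type*} (s : Finset ι) (F : ι → NCS K) (w : Word) :
    (∑ i ∈ s, F i) w = ∑ i ∈ s, F i w := Finset.sum_apply w s F

lemma mul_inv_self (f : NCS K) (hf : f [] = 1) : f * f⁻¹ = 1 := by
  funext w
  have h0 : (1 - f : NCS K) [] = 0 := by rw [sub_apply, hf, one_apply]; simp
  set S : NCS K := ∑ k ∈ Finset.range (w.length + 1), (1 - f) ^ k with hS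
  have h1 : (f * f⁻¹) w = (f * S) w := by
    rw [mul_apply, mul_apply]
    refine Finset.sum_congr rfl fun i hi => ?_
    congr 1
    rw [hS, fsum_apply]
    show ∑ k ∈ Finset.range ((w.drop i).length + 1), ((1 - f) ^ k) (w.drop i) = _
    refine Finset.sum_subset ?_ ?_
    · intro k; simp; omega
    · intro k _ hk
      apply pow_apply_zero _ h0
      simp at hk ⊢
      omega
  rw [h1]
  have h2 : f * S = 1 - (1 - f) ^ (w.length + 1) := by
    have := mul_neg_geom_sum (1 - f) (w.length + 1)
    rwa [sub_sub_cancel] at this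
  rw [h2, sub_apply, pow_apply_zero _ h0 _ _ (Nat.lt_succ_self _), sub_zero]

/-- recursive form of the substitution `e1 ↦ e∞` -/
def T : Word → (Word → K) → K
  | [], f => f []
  | b :: v, f => if b = 0 then T v (fun w => f (0 :: w)) - T v (fun w => f (1 :: w))
      else - T v (fun w => f (1 :: w))

lemma T_zero (v : Word) : T v (fun _ => (0 : K)) = 0 := by
  induction v with
  | nil => rfl
  | cons b v ih => simp [T, ih]

lemma T_add (v : Word) (f g : Word → K) : T v (fun w => f w + g w) = T v f + T v g := by
  induction v generalizing f g with
  | nil => rfl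
  | cons b v ih =>
    simp only [T, ih]
    split_ifs <;> ring

lemma T_sub (v : Word) (f g : Word → K) : T v (fun w => f w - g w) = T v f - T v g := by
  induction v generalizing f g with
  | nil => rfl
  | cons b v ih =>
    simp only [T, ih]
    split_ifs <;> ring

lemma ins_sub (c : Fin 2) (v : Word) (f g : Word → K) :
    ins c v (fun w => f w - g w) = ins c v f - ins c v g := by
  induction v generalizing f g with
  | nil => rfl
  | cons b v ih =>
    simp only [ins, ih]
    ring

lemma ins_neg (c : Fin 2) (v : Word) (f : Word → K) :
    ins c v (fun w => - f w) = - ins c v f := by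
  induction v generalizing f with
  | nil => rfl
  | cons b v ih =>
    simp only [ins, ih]
    ring

lemma ins_T (v : Word) (f : Word → K) :
    ins 0 v (fun w => T w f) = T v (fun w => ins 0 w f) - T v (fun w => ins 1 w f) := by
  induction v generalizing f with
  | nil => simp [ins, T]
  | cons b v ih =>
    have hb : b = 0 ∨ b = 1 := by omega
    rcases hb with rfl | rfl
    · simp only [ins, T, if_true, T_add, ins_sub, ih]
      ring
    · simp only [ins, T, if_true, T_add, ins_neg, ih, one_ne_zero, if_false]
      ring

lemma mem_wordsLe (n : ℕ) (w : Word) : w ∈ wordsLe n ↔ w.length ≤ n := by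
  simp only [wordsLe, Finset.mem_biUnion, Finset.mem_range, Finset.mem_image, Finset.mem_univ,
    true_and]
  constructor
  · rintro ⟨k, hk, t, rfl⟩
    simp; omega
  · intro h
    exact ⟨w.length, by omega, w.get, List.ofFn_get w⟩

lemma sum_wordsLe_succ (n : ℕ) (F : Word → K) :
    ∑ w ∈ wordsLe (n + 1), F w
      = F [] + ∑ w ∈ wordsLe n, F (0 :: w) + ∑ w ∈ wordsLe n, F (1 :: w) := by
  have h : wordsLe (n + 1) = insert [] ((wordsLe n).image (fun w => (0 : Fin 2) :: w) ∪
      (wordsLe n).image (fun w => (1 : Fin 2) :: w)) := by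
    ext w
    simp only [Finset.mem_insert, Finset.mem_union, Finset.mem_image, mem_wordsLe]
    cases w with
    | nil => simp
    | cons b v =>
      have hb : b = 0 ∨ b = 1 := by omega
      rcases hb with rfl | rfl <;> simp
  rw [h, Finset.sum_insert (by simp), Finset.sum_union, Finset.sum_image, Finset.sum_image, add_assoc]
  · intro a _ b _; simp
  · intro a _ b _; simp
  · rw [Finset.disjoint_left]
    intro w
    simp only [Finset.mem_image]
    rintro ⟨a, _, rfl⟩ ⟨b, _, hb⟩
    simp at hb

lemma shift_Einf0 : shift 0 (Einf : NCS K) = -1 := by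
  have : shift 0 (Einf : NCS K) = - shift 0 E0 - shift 0 E1 := rfl
  rw [this, shift00, shift01, sub_zero]
lemma shift_Einf1 : shift 1 (Einf : NCS K) = -1 := by
  have : shift 1 (Einf : NCS K) = - shift 1 E0 - shift 1 E1 := rfl
  rw [this, shift10, shift11]; simp
lemma Einf_nil : (Einf : NCS K) [] = 0 := by simp [Einf, sub_apply, neg_apply, E0_nil, E1_nil]

lemma prodWord_cons0 (a b : NCS K) (w : Word) : prodWord a b (0 :: w) = a * prodWord a b w := by
  simp [prodWord]
lemma prodWord_cons1 (a b : NCS K) (w : Word) : prodWord a b (1 :: w) = b * prodWord a b w := by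
  simp [prodWord]

lemma subst_eq_T (f : NCS K) (v : Word) : subst E0 Einf f v = T v f := by
  induction v generalizing f with
  | nil =>
    have : wordsLe 0 = {[]} := by ext w; simp [mem_wordsLe]
    simp [subst, T, this, prodWord, one_apply]
  | cons b v ih =>
    have key : subst E0 Einf f (b :: v) = ∑ w ∈ wordsLe (v.length + 1), f w * prodWord E0 Einf w (b :: v) := rfl
    have h0 : ∀ g : NCS K, subst E0 Einf g v = ∑ w ∈ wordsLe v.length, g w * prodWord E0 Einf w v :=
      fun g => rfl
    rw [key, sum_wordsLe_succ]
    have e0 : prodWord E0 Einf [] (b :: v) = (0 : K) := by simp [prodWord, one_apply]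
    rw [e0, mul_zero, zero_add]
    have hb : b = 0 ∨ b = 1 := by omega
    rcases hb with rfl | rfl
    · have i0 : T (0 :: v) f = subst E0 Einf (shift 0 f) v - subst E0 Einf (shift 1 f) v := by
        rw [ih, ih]; rfl
      rw [i0, h0, h0, ← Finset.sum_add_distrib, ← Finset.sum_sub_distrib]
      refine Finset.sum_congr rfl fun w _ => ?_
      rw [prodWord_cons0, prodWord_cons1, cons_mul, cons_mul, shift_Einf0, shift00, E0_nil, Einf_nil,
        one_mul, zero_mul, zero_add, zero_add, neg_mul, one_mul, neg_apply]
      show f (0 :: w) * _ + f (1 :: w) * _ = f (0 :: w) * _ - f (1 :: w) * _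
      ring
    · have i0 : T (1 :: v) f = - subst E0 Einf (shift 1 f) v := by
        rw [ih]; rfl
      rw [i0, h0, ← Finset.sum_add_distrib, ← Finset.sum_neg_distrib]
      refine Finset.sum_congr rfl fun w _ => ?_
      rw [prodWord_cons0, prodWord_cons1, cons_mul, cons_mul, shift_Einf1, shift10, E0_nil, Einf_nil,
        zero_mul, zero_mul, zero_apply, zero_add, zero_add, neg_mul, one_mul, neg_apply,
        mul_zero, zero_add]
      show f (1 :: w) * _ = - (f (1 :: w) * _)
      ring

lemma ins_replicate (c : Fin 2) (k : ℕ) (f : Word → K) :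
    ins c (List.replicate k c) f = ((k : K) + 1) * f (List.replicate (k + 1) c) := by
  induction k generalizing f with
  | zero => simp [ins]
  | succ k ih =>
    rw [List.replicate_succ, ins, ih]
    simp only [List.replicate_succ]
    push_cast; ring

lemma ins_replicate_append (k : ℕ) (w : Word) (f : Word → K) :
    ins 0 (List.replicate k 0 ++ 1 :: w) f = ((k : K) + 1) * f (List.replicate (k + 1) 0 ++ 1 :: w)
      + ins 0 w (fun v => f (List.replicate k 0 ++ 1 :: v)) := by
  induction k generalizing f with
  | zero => simp [ins]
  | succ k ih =>
    rw [List.replicate_succ, List.cons_append, ins, ih]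
    simp only [List.replicate_succ, List.cons_append]
    push_cast; ring

end aux1

section words

lemma depth_append (u v : Word) : depth (u ++ v) = depth u + depth v := List.count_append
lemma depth_cons1 (v : Word) : depth (1 :: v) = depth v + 1 := by simp [depth]
lemma depth_cons0 (v : Word) : depth (0 :: v) = depth v := by simp [depth]
lemma depth_zero (w : Word) (h : depth w = 0) : w = List.replicate w.length 0 := by
  rw [List.eq_replicate_iff]
  refine ⟨rfl, fun b hb => ?_⟩
  have h1 : (1 : Fin 2) ∉ w := by simpa [depth, List.count_eq_zero] using h
  have hb' : b = 0 ∨ b = 1 := by omega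
  rcases hb' with rfl | rfl
  · rfl
  · exact absurd hb h1

lemma word_form (w : Word) :
    (∃ k, w = List.replicate k 1) ∨ ∃ u k, w = u ++ 0 :: List.replicate k 1 := by
  induction w with
  | nil => exact Or.inl ⟨0, rfl⟩
  | cons b v ih =>
    have hb : b = 0 ∨ b = 1 := by omega
    rcases ih with ⟨k, rfl⟩ | ⟨u, k, rfl⟩
    · rcases hb with rfl | rfl
      · exact Or.inr ⟨[], k, rfl⟩
      · exact Or.inl ⟨k + 1, rfl⟩
    · exact Or.inr ⟨b :: u, k, rfl⟩

lemma wordA_zero (a : ℕ → ℕ) : wordA 0 a = List.replicate (a 0) 0 := by simp [wordA]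

lemma wordA_succ (d : ℕ) (a : ℕ → ℕ) :
    wordA (d + 1) a = List.replicate (a (d + 1)) 0 ++ 1 :: wordA d a := by
  simp only [wordA, List.ofFn_succ, List.flatten_cons, Fin.val_zero, List.cons_append, Fin.val_succ]
  congr 3
  simp only [Nat.add_sub_cancel]
  congr 3
  funext j
  congr 3
  omega

lemma wordA_congr (d : ℕ) (a b : ℕ → ℕ) (h : ∀ i ≤ d, a i = b i) : wordA d a = wordA d b := by
  induction d with
  | zero => simp [wordA_zero, h]
  | succ d ih => rw [wordA_succ, wordA_succ, h _ le_rfl, ih fun i hi => h i (by omega)]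

lemma depth_replicate0 (k : ℕ) : depth (List.replicate k 0) = 0 := by
  simp [depth, List.count_replicate]

lemma depth_wordA (d : ℕ) (a : ℕ → ℕ) : depth (wordA d a) = d := by
  induction d with
  | zero => simp [wordA_zero, depth_replicate0]
  | succ d ih => rw [wordA_succ, depth_append, depth_cons1, ih, depth_replicate0]; omega

lemma wordA_snoc (d : ℕ) (a : ℕ → ℕ) :
    wordA d (Function.update a 0 (a 0 + 1)) = wordA d a ++ [0] := by
  induction d with
  | zero => simp [wordA_zero, List.replicate_succ']
  | succ d ih => rw [wordA_succ, wordA_succ, ih]; simp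

lemma wordA_cons (d : ℕ) (a : ℕ → ℕ) :
    wordA (d + 1) (Function.update a (d + 1) (a (d + 1) + 1)) = 0 :: wordA (d + 1) a := by
  rw [wordA_succ, wordA_succ, wordA_congr d _ a]
  · simp [List.replicate_succ]
  · intro i hi
    rw [Function.update_of_ne]; omega

lemma ins_wordA {K : Type*} [CommRing K] (d : ℕ) (a : ℕ → ℕ) (f : Word → K) :
    ins 0 (wordA d a) f = ∑ i ∈ Finset.range (d + 1),
      ((a i : K) + 1) * f (wordA d (Function.update a i (a i + 1))) := by
  induction d generalizing f with
  | zero => simp [wordA_zero, ins_replicate]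
  | succ d ih =>
    rw [Finset.sum_range_succ, wordA_succ, ins_replicate_append, ih, add_comm]
    congr 1
    · refine Finset.sum_congr rfl fun i hi => ?_
      have := Finset.mem_range.1 hi
      rw [wordA_succ, Function.update_of_ne (by omega)]
    · rw [wordA_cons, wordA_succ, List.replicate_succ, List.cons_append]

end words

section main
variable {K : Type*} [Field K] [CharZero K]

lemma qdiv_mem (B : Subalgebra ℚ K) (k : ℕ) (x : K) (h : ((k : K) + 1) * x ∈ B) : x ∈ B := by
  have h1 := B.smul_mem h (((k : ℚ) + 1)⁻¹)
  rw [Algebra.smul_def] at h1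
  have : (algebraMap ℚ K) (((k : ℚ) + 1)⁻¹) * (((k : K) + 1) * x) = x := by
    have hk : ((k : K) + 1) ≠ 0 := by exact_mod_cast Nat.succ_ne_zero k
    simp only [map_inv₀, map_add, map_natCast, map_one]
    field_simp
  rwa [this] at h1

lemma rep_zero (c : Fin 2) (f : NCS K) (hf : ∀ w, ins c w f = 0) (k : ℕ) (hk : k ≠ 0) :
    f (List.replicate k c) = 0 := by
  obtain ⟨k, rfl⟩ := Nat.exists_eq_succ_of_ne_zero hk
  have h := (ins_replicate c k f).symm.trans (hf (List.replicate k c))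
  have hk : ((k : K) + 1) ≠ 0 := by exact_mod_cast Nat.succ_ne_zero k
  exact (mul_eq_zero.1 h).resolve_left hk

lemma depth0_zero (f : NCS K) (hf : ∀ w, ins 0 w f = 0) (w : Word) (hw : depth w = 0)
    (hne : w ≠ []) : f w = 0 := by
  rw [depth_zero w hw]
  exact rep_zero 0 f hf _ (by simpa using hne)

lemma reg_step (B : Subalgebra ℚ K) (k : ℕ) (u : Word) (f : Word → K)
    (H : ∀ u', depth u' = depth u + 1 → f (u' ++ 0 :: List.replicate k 1) ∈ B) :
    ins 1 (u ++ 0 :: List.replicate k 1) f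
      - ((k : K) + 1) * f (u ++ 0 :: List.replicate (k + 1) 1) ∈ B := by
  induction u generalizing f with
  | nil =>
    rw [List.nil_append, ins, ins_replicate, List.nil_append, add_sub_cancel_right]
    exact H [1] (by simp [depth])
  | cons b u ih =>
    rw [List.cons_append, ins, List.cons_append, add_sub_assoc]
    refine B.add_mem ?_ (ih (fun w => f (b :: w)) ?_)
    · exact H (1 :: b :: u) (depth_cons1 _)
    · intro u' hu'
      refine H (b :: u') ?_
      simp only [depth, List.count_cons] at hu' ⊢
      omega

lemma reg_mem (B : Subalgebra ℚ K) (f : NCS K) (hf1 : ∀ w, ins 1 w f = 0) (hnil : f [] = 1) (i : ℕ)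
    (H : ∀ u, depth u = i → f (u ++ [0]) ∈ B) (w : Word) (hw : depth w = i) : f w ∈ B := by
  rcases word_form w with ⟨k, rfl⟩ | ⟨u, k, rfl⟩
  · rcases Nat.eq_zero_or_pos k with rfl | hk
    · simp [hnil, B.one_mem]
    · rw [rep_zero 1 f hf1 k (by omega)]; exact B.zero_mem
  · induction k generalizing u with
    | zero =>
      refine H u ?_
      simpa [depth] using hw
    | succ k ih =>
      apply qdiv_mem B k
      have := reg_step B k u f ?_
      · rw [hf1, zero_sub] at this
        simpa using B.neg_mem this
      · intro u' hu'
        apply ih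
        simp only [depth, List.count_append, List.count_cons, List.count_replicate] at hu' hw ⊢
        simp at hw ⊢
        omega

lemma X_depth0 (f X : NCS K) (hf0 : ∀ w, ins 0 w f = 0) (hnil : f [] = 1) (hX : f * X = E1 * f)
    (w : Word) (hw : depth w = 0) : X w = 0 := by
  have h1 : (f * X) w = X w := by
    rw [mul_apply, Finset.sum_range_succ']
    simp only [List.take_zero, List.drop_zero, hnil, one_mul]
    rw [add_eq_right]
    refine Finset.sum_eq_zero fun i hi => ?_
    have := Finset.mem_range.1 hi
    rw [depth0_zero f hf0, zero_mul]
    · have : depth (w.take (i+1)) + depth (w.drop (i+1)) = depth w := by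
        rw [← depth_append, List.take_append_drop]
      omega
    · intro h0
      rw [List.take_eq_nil_iff] at h0
      rcases h0 with h0 | h0
      · omega
      · simp [h0] at this
  rw [← h1, hX]
  cases w with
  | nil => rw [mul_nil, E1_nil, zero_mul]
  | cons b v =>
    have hb : b = 0 ∨ b = 1 := by omega
    rcases hb with rfl | rfl
    · rw [E1_mul_cons0]
    · simp [depth_cons1] at hw

lemma X_depth1 (f X : NCS K) (hf0 : ∀ w, ins 0 w f = 0) (hnil : f [] = 1) (hX : f * X = E1 * f)
    (w : Word) (hw : depth w = 1) (hne : w ≠ [1]) : X w = 0 := by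
  have h1 : (f * X) w = X w := by
    rw [mul_apply, Finset.sum_range_succ']
    simp only [List.take_zero, List.drop_zero, hnil, one_mul]
    rw [add_eq_right]
    refine Finset.sum_eq_zero fun i hi => ?_
    have hi' := Finset.mem_range.1 hi
    have hsum : depth (w.take (i+1)) + depth (w.drop (i+1)) = depth w := by
      rw [← depth_append, List.take_append_drop]
    rcases Nat.eq_zero_or_pos (depth (w.take (i+1))) with h0 | hpos
    · rw [depth0_zero f hf0 _ h0, zero_mul]
      intro h0
      rw [List.take_eq_nil_iff] at h0
      rcases h0 with h0 | h0
      · omega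
      · simp [h0] at hi'
    · rw [X_depth0 f X hf0 hnil hX (w.drop (i+1)) (by omega), mul_zero]
  rw [← h1, hX]
  cases w with
  | nil => rw [mul_nil, E1_nil, zero_mul]
  | cons b v =>
    have hb : b = 0 ∨ b = 1 := by omega
    rcases hb with rfl | rfl
    · rw [E1_mul_cons0]
    · rw [E1_mul_cons1]
      refine depth0_zero f hf0 v ?_ ?_
      · simpa [depth_cons1] using hw
      · rintro rfl; exact hne rfl

/-- recovering `f` from `X = f⁻¹ e1 f` -/
lemma f_mem (B : Subalgebra ℚ K) (f X : NCS K) (hf0 : ∀ w, ins 0 w f = 0)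
    (hf1 : ∀ w, ins 1 w f = 0) (hnil : f [] = 1) (hX : f * X = E1 * f) (n : ℕ)
    (hXB : ∀ w, depth w ≤ n + 1 → X w ∈ B) (i : ℕ) : i ≤ n → ∀ w, depth w = i → f w ∈ B := by
  induction i using Nat.strong_induction_on with
  | _ i ih =>
    intro hi
    refine reg_mem B f hf1 hnil i fun u hu => ?_
    have h1 : (f * X) (1 :: (u ++ [0])) - X (1 :: (u ++ [0])) ∈ B := by
      refine mul_sub_mem B f X hnil _ fun p q hp hpq => ?_
      have hd : depth p + depth q = i + 1 := by
        rw [← depth_append, ← hpq, depth_cons1, depth_append, hu]; simp [depth]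
      by_cases hq0 : depth q = 0
      · rw [X_depth0 f X hf0 hnil hX q hq0, mul_zero]; exact B.zero_mem
      by_cases hq1 : depth q = 1
      · rw [X_depth1 f X hf0 hnil hX q hq1, mul_zero]; exact B.zero_mem
        rintro rfl
        rw [← List.cons_append] at hpq
        have := (List.append_inj' hpq rfl).2
        simp at this
      · exact B.mul_mem (ih (depth p) (by omega) (by omega) p rfl) (hXB q (by omega))
    rw [hX, E1_mul_cons1] at h1
    have := B.add_mem h1 (hXB (1 :: (u ++ [0])) (by
      rw [depth_cons1, depth_append, hu]; simp [depth]; omega))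
    simpa using this

/-- membership of coefficients of `X` -/
lemma X_mem (B : Subalgebra ℚ K) (h X : NCS K) (hnil : h [] = 1)
    (hX : h * X = E0 * h - h * E0 + E1 * h) (n : ℕ)
    (hB : ∀ w, depth w ≤ n → h w ∈ B) (m : ℕ) : ∀ w : Word, w.length = m → depth w ≤ n → X w ∈ B := by
  induction m using Nat.strong_induction_on with
  | _ m ih =>
    intro w hm hw
    have h1 : (h * X) w - X w ∈ B := by
      refine mul_sub_mem B h X hnil _ fun p q hp hpq => ?_
      have hd : depth p + depth q = depth w := by rw [← depth_append, ← hpq]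
      have hl : p.length + q.length = w.length := by rw [hpq, List.length_append]
      have hp' : 0 < p.length := List.length_pos_iff.2 hp
      exact B.mul_mem (hB _ (by omega)) (ih q.length (by omega) q rfl (by omega))
    have h2 : (h * X) w ∈ B := by
      rw [hX, add_apply, sub_apply]
      have hE0 : ∀ v, (E0 : NCS K) v ∈ B := by
        intro v; unfold E0; split_ifs
        exacts [B.one_mem, B.zero_mem]
      have hE1 : ∀ v, (E1 : NCS K) v ∈ B := by
        intro v; unfold E1; split_ifs
        exacts [B.one_mem, B.zero_mem]
      have hd : ∀ i, depth (w.take i) + depth (w.drop i) = depth w := by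
        intro i; rw [← depth_append, List.take_append_drop]
      refine B.add_mem (B.sub_mem ?_ ?_) ?_ <;> rw [mul_apply] <;>
        refine B.sum_mem fun i _ => ?_ <;> have := hd i
      · exact B.mul_mem (hE0 _) (hB _ (by omega))
      · exact B.mul_mem (hB _ (by omega)) (hE0 _)
      · exact B.mul_mem (hE1 _) (hB _ (by omega))
    simpa using B.sub_mem h2 h1

/-- cyclic invariance modulo lower depth -/
lemma cyc_mem (B : Subalgebra ℚ K) (f h X : NCS K) (hf0 : ∀ w, ins 0 w f = 0)
    (hf1 : ∀ w, ins 1 w f = 0) (hfnil : f [] = 1) (hfX : f * X = E1 * f)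
    (hh0 : ∀ w, ins 0 w h = 0) (hhnil : h [] = 1)
    (hhX : h * X = E0 * h - h * E0 + E1 * h) (d : ℕ)
    (hB : ∀ w, depth w ≤ d → h w ∈ B) (w : Word) (hw : depth w = d + 1) :
    h (w ++ [0]) - h (0 :: w) ∈ B := by
  have hXB : ∀ v, depth v ≤ d → X v ∈ B := fun v hv => X_mem B h X hhnil hhX d hB _ v rfl hv
  have hX0 := X_depth0 f X hf0 hfnil hfX
  have hdw : depth (0 :: w ++ [0]) = d + 1 := by
    rw [depth_append, depth_cons0, hw]; simp [depth]
  have h1 : (f * X) (0 :: w ++ [0]) - X (0 :: w ++ [0]) ∈ B := by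
    refine mul_sub_mem B f X hfnil _ fun p q hp hpq => ?_
    have hd : depth p + depth q = d + 1 := by rw [← depth_append, ← hpq, hdw]
    by_cases hp0 : depth p = 0
    · rw [depth0_zero f hf0 p hp0 hp, zero_mul]; exact B.zero_mem
    by_cases hq0 : depth q = 0
    · rw [hX0 q hq0, mul_zero]; exact B.zero_mem
    by_cases hq1 : depth q = 1
    · rw [X_depth1 f X hf0 hfnil hfX q hq1, mul_zero]; exact B.zero_mem
      rintro rfl
      have := (List.append_inj' hpq rfl).2
      simp at this
    · refine B.mul_mem ?_ (hXB q (by omega))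
      obtain ⟨n, rfl⟩ : ∃ n, d = n + 1 := ⟨d - 1, by omega⟩
      exact f_mem B f X hf0 hf1 hfnil hfX n hXB (depth p) (by omega) p rfl
  rw [hfX, List.cons_append, E1_mul_cons0, zero_sub] at h1
  have h2 : (h * X) (0 :: w ++ [0]) - X (0 :: w ++ [0]) ∈ B := by
    refine mul_sub_mem B h X hhnil _ fun p q hp hpq => ?_
    have hd : depth p + depth q = d + 1 := by rw [← depth_append, ← hpq, hdw]
    by_cases hp0 : depth p = 0
    · rw [depth0_zero h hh0 p hp0 hp, zero_mul]; exact B.zero_mem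
    by_cases hq0 : depth q = 0
    · rw [hX0 q hq0, mul_zero]; exact B.zero_mem
    · exact B.mul_mem (hB p (by omega)) (hXB q (by omega))
  rw [hhX, add_apply, sub_apply, mul_E0_snoc, List.cons_append, E0_mul_cons0, E1_mul_cons0] at h2
  have := B.sub_mem h2 h1
  simpa [E0] using this

lemma update_add_single {m : ℕ} (t : Fin m → ℕ) (j : Fin m) :
    Function.update t j (t j + 1) = t + Pi.single j 1 := by
  funext i
  by_cases hij : i = j
  · subst hij; simp
  · simp [hij]

lemma sum_tuple {m : ℕ} (r : ℕ) (j : Fin m) (T' : (Fin m → ℕ) → K) :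
    ∑ v ∈ Finset.Nat.antidiagonalTuple m (r + 1), (v j : K) * T' v
      = ∑ u ∈ Finset.Nat.antidiagonalTuple m r, ((u j : K) + 1) * T' (u + Pi.single j 1) := by
  symm
  refine Finset.sum_of_injOn (fun u => u + Pi.single j 1) ?_ ?_ ?_ ?_
  · intro a _ b _ hab; simpa using hab
  · intro u hu
    simp only [Finset.mem_coe, Finset.Nat.mem_antidiagonalTuple] at hu ⊢
    simp [Finset.sum_add_distrib, hu]
  · intro v hv hnot
    have : v j = 0 := by
      by_contra h0
      apply hnot
      have hle : Pi.single j 1 ≤ v := by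
        intro i
        by_cases hij : i = j
        · subst hij; simp; omega
        · simp [hij]
      refine ⟨v - Pi.single j 1, ?_, tsub_add_cancel_of_le hle⟩
      simp only [Finset.mem_coe, Finset.Nat.mem_antidiagonalTuple] at hv ⊢
      have h3 : ∑ i, (v - Pi.single j 1 + Pi.single j 1 : Fin m → ℕ) i = r + 1 := by
        rw [tsub_add_cancel_of_le hle, hv]
      simp only [Pi.add_apply, Finset.sum_add_distrib] at h3
      simpa using h3
    simp [this]
  · intro u _; simp

/-- the combinatorial inversion -/
lemma comb (B : Subalgebra ℚ K) (m : ℕ) (G : ℕ → (Fin m → ℕ) → K)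
    (H : ∀ (N : ℕ) (t : Fin m → ℕ), ((N : K) + 2) * G (N + 1) t + ∑ j, ((t j : K) + 1) * G N (t + Pi.single j 1) ∈ B)
    (r N : ℕ) (t : Fin m → ℕ) :
    (Nat.choose (N + 1 + r) r : K) * G (N + r) t
      - ∑ u ∈ Finset.Nat.antidiagonalTuple m r,
          (∏ j, (nbinom (t j + 1) (u j) : K)) * G N (t + u) ∈ B := by
  induction r generalizing t with
  | zero =>
    have : Finset.Nat.antidiagonalTuple m 0 = {0} := Finset.Nat.antidiagonalTuple_zero_right m
    simp [this, nbinom, B.zero_mem]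
  | succ r ih =>
    apply qdiv_mem B r
    have hc : ((r : K) + 1) * (Nat.choose (N + 1 + (r + 1)) (r + 1) : K)
        = (Nat.choose (N + 1 + r) r : K) * ((N + r : ℕ) + 2) := by
      have := Nat.add_one_mul_choose_eq (N + 1 + r) r
      have h2 : (((N + 1 + r + 1) * (N + 1 + r).choose r : ℕ) : K)
        = (((N + 1 + r + 1).choose (r + 1) * (r + 1) : ℕ) : K) := by rw [this]
      push_cast at h2 ⊢
      rw [← add_assoc (N + 1) r 1]
      linear_combination -h2
    have hs : ((r : K) + 1) * ∑ u ∈ Finset.Nat.antidiagonalTuple m (r + 1),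
          (∏ j, (nbinom (t j + 1) (u j) : K)) * G N (t + u)
        = - ∑ j, ((t j : K) + 1) * ∑ u ∈ Finset.Nat.antidiagonalTuple m r,
          (∏ i, (nbinom ((t + Pi.single j 1 : Fin m → ℕ) i + 1) (u i) : K)) * G N (t + Pi.single j 1 + u) := by
      have e1 : ((r : K) + 1) * ∑ u ∈ Finset.Nat.antidiagonalTuple m (r + 1),
          (∏ j, (nbinom (t j + 1) (u j) : K)) * G N (t + u)
          = ∑ u ∈ Finset.Nat.antidiagonalTuple m (r + 1), ∑ j, (u j : K) *
          ((∏ j, (nbinom (t j + 1) (u j) : K)) * G N (t + u)) := by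
        rw [Finset.mul_sum]
        refine Finset.sum_congr rfl fun u hu => ?_
        rw [← Finset.sum_mul]
        congr 1
        rw [Finset.Nat.mem_antidiagonalTuple] at hu
        exact_mod_cast hu.symm
      rw [e1, Finset.sum_comm, ← Finset.sum_neg_distrib]
      refine Finset.sum_congr rfl fun j _ => ?_
      rw [sum_tuple, Finset.mul_sum, ← Finset.sum_neg_distrib]
      refine Finset.sum_congr rfl fun u _ => ?_
      have e2 : t + (u + Pi.single j 1) = t + Pi.single j 1 + u := by abel
      rw [e2, ← mul_assoc, ← mul_assoc, ← neg_mul]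
      congr 1
      rw [← Finset.mul_prod_erase _ _ (Finset.mem_univ j),
        ← Finset.mul_prod_erase _ _ (Finset.mem_univ j)]
      have e3 : ∏ x ∈ Finset.univ.erase j, (nbinom (t x + 1) ((u + Pi.single j 1 : Fin m → ℕ) x) : K)
          = ∏ x ∈ Finset.univ.erase j, (nbinom ((t + Pi.single j 1 : Fin m → ℕ) x + 1) (u x) : K) := by
        refine Finset.prod_congr rfl fun x hx => ?_
        have := Finset.ne_of_mem_erase hx
        simp [this]
      rw [e3, ← mul_assoc, ← mul_assoc, ← neg_mul]
      congr 1
      simp only [Pi.add_apply, Pi.single_eq_same, nbinom]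
      have e4 : t j + 1 + (u j + 1) - 1 = t j + u j + 1 := by omega
      have e5 : t j + 1 + 1 + u j - 1 = t j + u j + 1 := by omega
      rw [e4, e5]
      have e6 : (t j + u j + 1).choose (u j + 1) * (u j + 1) = (t j + u j + 1).choose (u j) * (t j + 1) := by
        have := Nat.choose_succ_right_eq (t j + u j + 1) (u j)
        rw [this]; congr 1; omega
      have e7 : (((t j + u j + 1).choose (u j + 1) * (u j + 1) : ℕ) : K)
        = (((t j + u j + 1).choose (u j) * (t j + 1) : ℕ) : K) := by rw [e6]
      push_cast at e7 ⊢
      rw [pow_succ]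
      linear_combination (-(-1) ^ u j) * e7
    rw [mul_sub, ← mul_assoc, hc, hs]
    have h1 := B.mul_mem (natCast_mem B (Nat.choose (N + 1 + r) r)) (H (N + r) t)
    have h2 : ∑ j, ((t j + 1 : ℕ) : K) * ((Nat.choose (N + 1 + r) r : K) * G (N + r) (t + Pi.single j 1)
      - ∑ u ∈ Finset.Nat.antidiagonalTuple m r,
          (∏ i, (nbinom ((t + Pi.single j 1 : Fin m → ℕ) i + 1) (u i) : K)) * G N (t + Pi.single j 1 + u)) ∈ B :=
      B.sum_mem fun j _ => B.mul_mem (natCast_mem B _) (ih (t + Pi.single j 1))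
    have h3 := B.sub_mem h1 h2
    convert h3 using 1
    have e8 : ∀ (S : Fin m → K), ∑ x, ((t x + 1 : ℕ) : K) *
          ((Nat.choose (N + 1 + r) r : K) * G (N + r) (t + Pi.single x 1) - S x)
       = (Nat.choose (N + 1 + r) r : K) * ∑ i, ((t i : K) + 1) * G (N + r) (t + Pi.single i 1)
         - ∑ i, ((t i : K) + 1) * S i := by
      intro S
      rw [Finset.mul_sum, ← Finset.sum_sub_distrib]
      exact Finset.sum_congr rfl fun i _ => by push_cast; ring
    rw [e8, ← add_assoc N r 1]
    ring

/-- exponents of `W(p; t; q)` -/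
def ex (m p q : ℕ) (t : Fin m → ℕ) : ℕ → ℕ :=
  fun i => if i = m + 1 then p else if i = 0 then q else extFin m t i

lemma ex_q (m p q : ℕ) (t : Fin m → ℕ) :
    Function.update (ex m p q t) 0 (ex m p q t 0 + 1) = ex m p (q + 1) t := by
  funext i
  by_cases h : i = 0
  · subst h; simp [ex]
  · simp [ex, h]

lemma ex_p (m p q : ℕ) (t : Fin m → ℕ) :
    Function.update (ex m p q t) (m + 1) (ex m p q t (m + 1) + 1) = ex m (p + 1) q t := by
  funext i
  by_cases h : i = m + 1
  · subst h; simp [ex]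
  · simp [ex, h]

lemma extFin_succ (m : ℕ) (t : Fin m → ℕ) (j : Fin m) : extFin m t (j + 1) = t j := by
  simp [extFin]

lemma ex_mid_apply (m p q : ℕ) (t : Fin m → ℕ) (j : Fin m) : ex m p q t (j + 1) = t j := by
  have : (j : ℕ) + 1 ≠ m + 1 := by have := j.2; omega
  simp only [ex, this, if_false, Nat.succ_ne_zero, extFin_succ]

lemma ex_mid (m p q : ℕ) (t : Fin m → ℕ) (j : Fin m) :
    Function.update (ex m p q t) (j + 1) (ex m p q t (j + 1) + 1)
      = ex m p q (t + Pi.single j 1) := by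
  funext i
  by_cases h : i = j + 1
  · subst h
    rw [Function.update_self, ex_mid_apply, ex_mid_apply]; simp
  · rw [Function.update_of_ne h]
    simp only [ex]
    congr 2
    simp only [extFin]
    split_ifs with hi
    · have : (⟨i - 1, hi.1⟩ : Fin m) ≠ j := by
        intro hj
        apply h
        rw [← hj]; simp; omega
      simp [this]
    · rfl

lemma shift_mem (B : Subalgebra ℚ K) (h : NCS K) (m : ℕ)
    (hc : ∀ w, depth w = m + 1 → h (w ++ [0]) - h (0 :: w) ∈ B) (q p : ℕ) (t : Fin m → ℕ) :
    h (wordA (m + 1) (ex m p q t)) - h (wordA (m + 1) (ex m (p + q) 0 t)) ∈ B := by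
  induction q generalizing p with
  | zero => simp [B.zero_mem]
  | succ q ih =>
    have h1 := hc (wordA (m + 1) (ex m p q t)) (depth_wordA _ _)
    rw [← wordA_snoc, ← wordA_cons, ex_q, ex_p] at h1
    have h2 := ih (p + 1)
    have := B.add_mem h1 h2
    rw [sub_add_sub_cancel] at this
    rwa [show p + (q + 1) = p + 1 + q by ring]

end main

end NCS

open NCS in
/-- the "adjoint" depth reduction for `Φ∞` by a variation of the
outermost exponents, `μ = 0` case. -/
theorem stmt_18 {K : Type*} [Field K] [CharZero K] (Φ : NCS K) (hΦ : IsPiT Φ)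
    (h : OneDim0 Φ) (Φinf : NCS K) (hinf : Φinf = subst E0 Einf Φ)
    (d : ℕ) (hd : 1 ≤ d) (s : ℕ → ℕ) (hs : ∀ i ≤ d, 1 ≤ s i) (rd r0 : ℕ) :
    (Nat.choose (s 0 + s d + r0 + rd - 1) (s 0 + s d - 1) : K)
        * Φinf (wordA d fun i =>
            if i = d then s d - 1 + rd else if i = 0 then s 0 - 1 + r0 else s i - 1)
      - ∑ u ∈ Finset.Nat.antidiagonalTuple (d - 1) (rd + r0),
          (∏ j : Fin (d - 1), (nbinom (s ((j : ℕ) + 1)) (u j) : K))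
            * Φinf (wordA d fun i =>
                if i = d then s d - 1
                else if i = 0 then s 0 - 1
                else s i - 1 + extFin (d - 1) u i)
      ∈ Algebra.adjoin ℚ {x : K | ∃ v : Word, depth v ≤ d - 1 ∧ x = Φinf v} := by
  subst hinf
  set Φinf := subst E0 Einf Φ with hdef
  obtain ⟨⟨hnil, hsh⟩, hl0, hl1⟩ := hΦ
  obtain ⟨-, -, hE⟩ := h
  rw [← hdef] at hE
  have hf0 : ∀ w, ins 0 w Φ = 0 := fun w => by
    have := hsh [0] w
    rw [hl0, zero_mul] at this
    exact (shufApply_single 0 w Φ).symm.trans this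
  have hf1 : ∀ w, ins 1 w Φ = 0 := fun w => by
    have := hsh [1] w
    rw [hl1, zero_mul] at this
    exact (shufApply_single 1 w Φ).symm.trans this
  have hT : Φinf = fun w => T w Φ := funext fun w => subst_eq_T Φ w
  have hh0 : ∀ w, ins 0 w Φinf = 0 := fun w => by
    rw [hT]
    refine (ins_T w Φ).trans ?_
    have i0 : (fun w => ins 0 w Φ) = fun _ => (0 : K) := funext hf0
    have i1 : (fun w => ins 1 w Φ) = fun _ => (0 : K) := funext hf1
    rw [i0, i1, T_zero, sub_zero]
  have hhnil : Φinf [] = 1 := by rw [hT]; exact hnil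
  clear_value Φinf
  set X : NCS K := Φ⁻¹ * E1 * Φ with hXdef
  have hfX : Φ * X = E1 * Φ := by
    rw [hXdef, ← mul_assoc, ← mul_assoc, mul_inv_self Φ hnil, one_mul]
  have hhX : Φinf * X = E0 * Φinf - Φinf * E0 + E1 * Φinf := by
    have e : Φinf * (Φinf⁻¹ * Einf * Φinf) = Einf * Φinf := by
      rw [← mul_assoc, ← mul_assoc, mul_inv_self Φinf hhnil, one_mul]
    have e2 : Φinf * (E0 + X + Φinf⁻¹ * Einf * Φinf) = 0 := by rw [hE, mul_zero]
    rw [mul_add, mul_add, e, Einf, sub_mul, neg_mul] at e2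
    rw [← sub_eq_zero, ← e2]
    abel
  obtain ⟨m, rfl⟩ : ∃ m, d = m + 1 := ⟨d - 1, by omega⟩
  change _ - ∑ u ∈ Finset.Nat.antidiagonalTuple m (rd + r0),
      (∏ j : Fin m, (nbinom (s ((j : ℕ) + 1)) (u j) : K))
        * Φinf (wordA (m + 1) fun i =>
            if i = m + 1 then s (m + 1) - 1
            else if i = 0 then s 0 - 1
            else s i - 1 + extFin m u i)
    ∈ Algebra.adjoin ℚ {x : K | ∃ v : Word, depth v ≤ m ∧ x = Φinf v}
  set B := Algebra.adjoin ℚ {x : K | ∃ v : Word, depth v ≤ m ∧ x = Φinf v} with hBdef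
  have hB : ∀ w, depth w ≤ m → Φinf w ∈ B := fun w hw => Algebra.subset_adjoin ⟨w, hw, rfl⟩
  have hc := cyc_mem B Φ Φinf X hf0 hf1 hnil hfX hh0 hhnil hhX m hB
  have hsm := shift_mem B Φinf m hc
  have H : ∀ (N : ℕ) (t : Fin m → ℕ), ((N : K) + 2) * Φinf (wordA (m + 1) (ex m (N + 1) 0 t))
      + ∑ j, ((t j : K) + 1) * Φinf (wordA (m + 1) (ex m N 0 (t + Pi.single j 1))) ∈ B := by
    intro N t
    have h1 := (ins_wordA (m + 1) (ex m N 0 t) Φinf).symm.trans (hh0 (wordA (m + 1) (ex m N 0 t)))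
    rw [Finset.sum_range_succ, Finset.sum_range_succ', ex_q, ex_p, Finset.sum_range] at h1
    simp only [ex_mid] at h1
    simp only [ex_mid_apply] at h1
    have h2 := hsm 1 N t
    have e1 : ex m N 0 t 0 = 0 := by simp [ex]
    have e2 : ex m N 0 t (m + 1) = N := by simp [ex]
    rw [e1, e2] at h1
    have h3 := B.neg_mem h2
    convert h3 using 1
    push_cast at h1
    linear_combination h1
  set t : Fin m → ℕ := fun j => s (j + 1) - 1 with ht
  have key := comb B m (fun N t => Φinf (wordA (m + 1) (ex m N 0 t))) H (rd + r0)
    (s (m + 1) - 1 + (s 0 - 1)) t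
  have hs0 := hs 0 (by omega)
  have hsd := hs (m + 1) le_rfl
  have mid : ∀ (u : Fin m → ℕ) (i : ℕ), i ≤ m + 1 → i ≠ m + 1 → i ≠ 0 →
      extFin m (t + u) i = s i - 1 + extFin m u i := by
    intro u i hi h1 h2
    have h3 : i - 1 < m ∧ 1 ≤ i := by omega
    simp only [extFin, h3, dif_pos, and_self, Pi.add_apply, ht]
    congr 3; omega
  have w2 : ∀ u : Fin m → ℕ, wordA (m + 1) (fun i => if i = m + 1 then s (m + 1) - 1
                else if i = 0 then s 0 - 1 else s i - 1 + extFin m u i)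
      = wordA (m + 1) (ex m (s (m + 1) - 1) (s 0 - 1) (t + u)) := by
    intro u
    refine wordA_congr _ _ _ fun i hi => ?_
    simp only [ex]
    split_ifs with h1 h2
    · rfl
    · rfl
    · rw [mid u i hi h1 h2]
  have w1 : wordA (m + 1) (fun i => if i = m + 1 then s (m + 1) - 1 + rd
                else if i = 0 then s 0 - 1 + r0 else s i - 1)
      = wordA (m + 1) (ex m (s (m + 1) - 1 + rd) (s 0 - 1 + r0) t) := by
    refine wordA_congr _ _ _ fun i hi => ?_
    simp only [ex]
    split_ifs with h1 h2
    · rfl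
    · rfl
    · have := mid 0 i hi h1 h2
      rw [add_zero] at this
      rw [this]; simp [extFin]
  simp only [w1, w2]
  have hch : (Nat.choose (s 0 + s (m + 1) + r0 + rd - 1) (s 0 + s (m + 1) - 1) : K)
      = (Nat.choose (s (m + 1) - 1 + (s 0 - 1) + 1 + (rd + r0)) (rd + r0) : K) := by
    congr 1
    rw [show s 0 + s (m + 1) + r0 + rd - 1 = s (m + 1) - 1 + (s 0 - 1) + 1 + (rd + r0) by omega,
      show s 0 + s (m + 1) - 1 = s (m + 1) - 1 + (s 0 - 1) + 1 by omega]
    exact Nat.choose_symm_add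
  have hnb : ∀ u : Fin m → ℕ, (∏ j : Fin m, (nbinom (s ((j : ℕ) + 1)) (u j) : K))
      = ∏ j : Fin m, (nbinom (t j + 1) (u j) : K) := by
    intro u
    refine Finset.prod_congr rfl fun j _ => ?_
    have := hs (j + 1) (by have := j.2; omega)
    rw [ht]; simp only
    rw [Nat.sub_add_cancel this]
  simp only [hnb, hch]
  have a1 := B.mul_mem (natCast_mem B (Nat.choose (s (m + 1) - 1 + (s 0 - 1) + 1 + (rd + r0)) (rd + r0)))
    (hsm (s 0 - 1 + r0) (s (m + 1) - 1 + rd) t)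
  have a2 : ∑ u ∈ Finset.Nat.antidiagonalTuple m (rd + r0),
      (∏ j : Fin m, (nbinom (t j + 1) (u j) : K)) *
        (Φinf (wordA (m + 1) (ex m (s (m + 1) - 1) (s 0 - 1) (t + u)))
          - Φinf (wordA (m + 1) (ex m (s (m + 1) - 1 + (s 0 - 1)) 0 (t + u)))) ∈ B :=
    B.sum_mem fun u _ => B.mul_mem (B.prod_mem fun j _ => intCast_mem B _) (hsm _ _ _)
  have a3 := B.sub_mem (B.add_mem key a1) a2
  convert a3 using 1
  simp only [mul_sub, Finset.sum_sub_distrib]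
  rw [show s (m + 1) - 1 + rd + (s 0 - 1 + r0) = s (m + 1) - 1 + (s 0 - 1) + (rd + r0) by ring]
  ring
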